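/- For every (b, s) ∈ F(d), ∫_ℝ R2(b, s; γ) dγ = −∫₀^{d} ∫₀^∞ ∫_ℝ [ Ψ(b(x)w − s(x)w, b(x)w + s(x)w; ρ y, 1 − ρ²) − Ψ(−t w, t w; ρ y, 1 − ρ²) + Ψ(−b(x)w − s(x)w, −b(x)w + s(x)w; −ρ y, 1 − ρ²) − Ψ(−t w, t w; −ρ y, 1 − ρ²) ] φ(y) dy · w f_W(w) dw dx. -/

import Mathlib

open MeasureTheory Set

/-- Standard normal density. -/
noncomputable def phi (x : ℝ) : ℝ := (Real.sqrt (2 * Real.pi))⁻¹ * Real.exp (-(x ^ 2) / 2)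

/-- Standard normal cumulative distribution function. -/
noncomputable def Phi (x : ℝ) : ℝ := ∫ u in Set.Iic x, phi u

/-- `Psi x y μ v = P(x ≤ Z ≤ y)` for `Z ~ N(μ, v)`. -/
noncomputable def Psi (x y μ v : ℝ) : ℝ :=
  ∫ z in Set.Icc x y, (Real.sqrt (2 * Real.pi * v))⁻¹ * Real.exp (-((z - μ) ^ 2) / (2 * v))

/-- Density of `W = √(Q/m)` where `Q ~ χ²_m`. -/
noncomputable def fW (m : ℕ) (w : ℝ) : ℝ :=
  if 0 < w then
    (2 * ((m : ℝ) / 2) ^ ((m : ℝ) / 2) / Real.Gamma ((m : ℝ) / 2)) * w ^ ((m : ℝ) - 1) *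
      Real.exp (-(m : ℝ) * w ^ 2 / 2)
  else 0

/-- `E(W) = ∫₀^∞ w f_W(w) dw`. -/
noncomputable def EW (m : ℕ) : ℝ := ∫ w in Set.Ioi (0 : ℝ), w * fW m w

/-- The class `F(d)` of pairs `(b, s)`: `b : ℝ → ℝ` odd and bounded, `s : [0,∞) → (0,∞)`
bounded, both continuous except possibly at finitely many points, with `b(x) = 0` for
`|x| ≥ d` and `s(x) = t` for `x ≥ d`. -/
structure MemF (d t : ℝ) (b s : ℝ → ℝ) : Prop where
  b_odd : ∀ x, b (-x) = -b x
  b_bdd : ∃ M : ℝ, ∀ x, |b x| ≤ M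
  s_pos : ∀ x, 0 ≤ x → 0 < s x
  s_bdd : ∃ M : ℝ, ∀ x, 0 ≤ x → s x ≤ M
  b_cont : ∃ S : Finset ℝ, ∀ x ∉ S, ContinuousAt b x
  s_cont : ∃ S : Finset ℝ, ∀ x, 0 ≤ x → x ∉ S → ContinuousAt s x
  b_zero : ∀ x, d ≤ |x| → b x = 0
  s_eq_t : ∀ x, d ≤ x → s x = t

/-- Scaled expected-length excess `R1(b,s;γ)` (it depends on `(b,s)` only through `s`). -/
noncomputable def R1 (m : ℕ) (t d : ℝ) (s : ℝ → ℝ) (γ : ℝ) : ℝ :=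
  (1 / (t * EW m)) *
    ∫ w in Set.Ioi (0 : ℝ),
      (∫ x in (-d)..d, (s |x| - t) * phi (w * x - γ)) * (w ^ 2 * fW m w)

/-- `k†(h, w, γ) = Ψ(−tw, tw; ρ(h−γ), 1−ρ²)`. -/
noncomputable def kdag (t ρ h w γ : ℝ) : ℝ :=
  Psi (-(t * w)) (t * w) (ρ * (h - γ)) (1 - ρ ^ 2)

/-- `k(h, w, γ) = Ψ(b(h/w)w − s(|h|/w)w, b(h/w)w + s(|h|/w)w; ρ(h−γ), 1−ρ²)`. -/
noncomputable def kfun (b s : ℝ → ℝ) (ρ h w γ : ℝ) : ℝ :=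
  Psi (b (h / w) * w - s (|h| / w) * w) (b (h / w) * w + s (|h| / w) * w)
    (ρ * (h - γ)) (1 - ρ ^ 2)

/-- Minus the coverage-probability excess, `R2(b,s;γ)`. -/
noncomputable def R2 (m : ℕ) (t d ρ : ℝ) (b s : ℝ → ℝ) (γ : ℝ) : ℝ :=
  -∫ w in Set.Ioi (0 : ℝ),
      (∫ x in (-d)..d, (kfun b s ρ (w * x) w γ - kdag t ρ (w * x) w γ) * phi (w * x - γ)) *
        (w * fW m w)

lemma measurable_of_continuousAt_compl_finset {f : ℝ → ℝ} (S : Finset ℝ)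
    (hf : ∀ x ∉ S, ContinuousAt f x) : Measurable f := by
  refine measurable_of_measurable_on_compl_finite (S : Set ℝ) S.finite_toSet ?_
  have hc : ContinuousOn f (S : Set ℝ)ᶜ := fun x hx =>
    (hf x (by simpa using hx)).continuousWithinAt
  exact hc.domRestrict.measurable

lemma MemF.measurable_b {d t : ℝ} {b s : ℝ → ℝ} (h : MemF d t b s) : Measurable b := by
  obtain ⟨S, hS⟩ := h.b_cont
  exact measurable_of_continuousAt_compl_finset S hS

lemma MemF.measurable_s_abs {d t : ℝ} {b s : ℝ → ℝ} (h : MemF d t b s) :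
    Measurable fun x => s |x| := by
  classical
  obtain ⟨S, hS⟩ := h.s_cont
  refine measurable_of_continuousAt_compl_finset (S ∪ S.image Neg.neg) fun x hx => ?_
  have hx' : |x| ∉ S := by
    intro hmem
    apply hx
    rcases abs_choice x with h | h <;> rw [h] at hmem
    · simp [hmem]
    · simp only [Finset.mem_union, Finset.mem_image]
      exact Or.inr ⟨-x, hmem, neg_neg x⟩
  exact ContinuousAt.comp (f := fun x : ℝ => |x|) (hS |x| (abs_nonneg x) hx')
    continuous_abs.continuousAt

lemma phi_eq_gaussianPDFReal : phi = ProbabilityTheory.gaussianPDFReal 0 1 := by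
  ext x
  simp [phi, ProbabilityTheory.gaussianPDFReal]

lemma phi_neg (x : ℝ) : phi (-x) = phi x := by simp [phi]

lemma integrable_phi : Integrable phi := by
  rw [phi_eq_gaussianPDFReal]
  exact ProbabilityTheory.integrable_gaussianPDFReal 0 1

lemma Psi_eq_setIntegral_gaussianPDFReal (x y μ : ℝ) {v : ℝ} (hv : 0 ≤ v) :
    Psi x y μ v = ∫ z in Set.Icc x y, ProbabilityTheory.gaussianPDFReal μ ⟨v, hv⟩ z := rfl

lemma Psi_mem_Icc (x y μ : ℝ) {v : ℝ} (hv : 0 < v) : Psi x y μ v ∈ Set.Icc (0 : ℝ) 1 := by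
  have hv' : (⟨v, hv.le⟩ : NNReal) ≠ 0 := fun h => hv.ne' (congrArg NNReal.toReal h)
  rw [Psi_eq_setIntegral_gaussianPDFReal x y μ hv.le]
  refine ⟨integral_nonneg fun z => ProbabilityTheory.gaussianPDFReal_nonneg _ _ z, ?_⟩
  rw [← ProbabilityTheory.integral_gaussianPDFReal_eq_one μ hv']
  exact setIntegral_le_integral (ProbabilityTheory.integrable_gaussianPDFReal _ _)
    (ae_of_all _ fun z => ProbabilityTheory.gaussianPDFReal_nonneg _ _ z)

lemma Measurable.Psi {α : Type*} [MeasurableSpace α] {x y μ : α → ℝ} (v : ℝ)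
    (hx : Measurable x) (hy : Measurable y) (hμ : Measurable μ) :
    Measurable fun a => Psi (x a) (y a) (μ a) v := by
  have hset : MeasurableSet {p : α × ℝ | x p.1 ≤ p.2 ∧ p.2 ≤ y p.1} :=
    (measurableSet_le (hx.comp measurable_fst) measurable_snd).inter
      (measurableSet_le measurable_snd (hy.comp measurable_fst))
  have hden : Measurable fun p : α × ℝ =>
      (Real.sqrt (2 * Real.pi * v))⁻¹ * Real.exp (-((p.2 - μ p.1) ^ 2) / (2 * v)) := by
    fun_prop
  have key := ((hden.indicator hset).stronglyMeasurable.integral_prod_right'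
    (ν := (volume : Measure ℝ))).measurable
  convert key using 2 with a
  rw [_root_.Psi, ← integral_indicator measurableSet_Icc]
  rfl

lemma integrable_mul_fW {m : ℕ} (hm : 0 < m) :
    Integrable (fun w => w * fW m w) (volume.restrict (Set.Ioi (0 : ℝ))) := by
  have hm' : (0 : ℝ) < m := by exact_mod_cast hm
  have h := (integrableOn_rpow_mul_exp_neg_mul_sq (b := (m : ℝ) / 2) (by positivity)
    (s := (m : ℝ)) (by linarith)).const_mul
      (2 * ((m : ℝ) / 2) ^ ((m : ℝ) / 2) / Real.Gamma ((m : ℝ) / 2))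
  refine IntegrableOn.congr_fun h (fun w hw => ?_) measurableSet_Ioi
  have hw : 0 < w := hw
  have hpow : w ^ (m : ℝ) = w * w ^ ((m : ℝ) - 1) := by
    rw [Real.rpow_sub_one hw.ne']
    field_simp
  have hexp : -((m : ℝ) / 2) * w ^ 2 = -(m : ℝ) * w ^ 2 / 2 := by ring
  simp only [fW, if_pos hw, hpow, hexp]
  ring

/-- Fubini's theorem combined with reflection and translation of the innermost variable. -/
lemma integral_integral_integral_sub_left {μ ν : Measure ℝ} [SFinite μ] [SFinite ν]
    {G : ℝ → ℝ → ℝ → ℝ} {τ : ℝ → ℝ → ℝ} (hτ : Measurable (Function.uncurry τ))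
    (hG : Integrable (fun p : (ℝ × ℝ) × ℝ => G p.1.1 p.1.2 p.2) ((μ.prod ν).prod volume)) :
    ∫ γ, ∫ w, ∫ x, G w x (τ w x - γ) ∂ν ∂μ = ∫ x, ∫ w, (∫ y, G w x y) ∂μ ∂ν := by
  have hmp : MeasurePreserving (fun p : (ℝ × ℝ) × ℝ => (p.1, τ p.1.1 p.1.2 - p.2))
      ((μ.prod ν).prod volume) ((μ.prod ν).prod volume) := by
    refine (MeasurePreserving.id (μ.prod ν)).skew_product
      (g := fun q y => τ q.1 q.2 - y) ?_ (ae_of_all _ fun q => ?_)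
    · exact (hτ.comp measurable_fst).sub measurable_snd
    · exact (Measure.measurePreserving_sub_left volume (τ q.1 q.2)).map_eq
  have hH : Integrable (fun p : (ℝ × ℝ) × ℝ => G p.1.1 p.1.2 (τ p.1.1 p.1.2 - p.2))
      ((μ.prod ν).prod volume) := hmp.integrable_comp_of_integrable hG
  calc ∫ γ, ∫ w, ∫ x, G w x (τ w x - γ) ∂ν ∂μ
      = ∫ γ, ∫ q : ℝ × ℝ, G q.1 q.2 (τ q.1 q.2 - γ) ∂(μ.prod ν) := by
        refine integral_congr_ae ?_
        filter_upwards [hH.prod_left_ae] with γ hγ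
        exact integral_integral hγ
    _ = ∫ q : ℝ × ℝ, (∫ γ, G q.1 q.2 (τ q.1 q.2 - γ)) ∂(μ.prod ν) :=
        (integral_integral_swap hH).symm
    _ = ∫ q : ℝ × ℝ, (∫ y, G q.1 q.2 y) ∂(μ.prod ν) := by
        refine integral_congr_ae (ae_of_all _ fun q => ?_)
        exact integral_sub_left_eq_self (fun y => G q.1 q.2 y) volume (τ q.1 q.2)
    _ = ∫ x, ∫ w, (∫ y, G w x y) ∂μ ∂ν := integral_prod_symm _ hG.integral_prod_left

lemma integral_neg_to_self_eq_integral_add_neg {f : ℝ → ℝ} {d : ℝ} (hd : 0 ≤ d)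
    (hf : IntervalIntegrable f volume (-d) d) :
    ∫ x in (-d)..d, f x = ∫ x in (0 : ℝ)..d, (f x + f (-x)) := by
  have h₁ : IntervalIntegrable f volume (-d) 0 :=
    hf.mono_set (by
      rw [Set.uIcc_of_le (by linarith), Set.uIcc_of_le (by linarith)]
      exact Set.Icc_subset_Icc le_rfl hd)
  have h₂ : IntervalIntegrable f volume 0 d :=
    hf.mono_set (by
      rw [Set.uIcc_of_le hd, Set.uIcc_of_le (by linarith)]
      exact Set.Icc_subset_Icc (by linarith) le_rfl)
  have h₃ : IntervalIntegrable (fun x => f (-x)) volume 0 d := by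
    simpa using ((IntervalIntegrable.iff_comp_neg (by simp)).1 h₁).symm
  rw [intervalIntegral.integral_add h₂ h₃, intervalIntegral.integral_comp_neg, neg_zero,
    add_comm, intervalIntegral.integral_add_adjacent_intervals h₁ h₂]

/-- The integrand of `R2` at `h = w * x` as a function of `y = h - γ`. -/
noncomputable def excess (t v ρ : ℝ) (b s : ℝ → ℝ) (w x y : ℝ) : ℝ :=
  Psi (b x * w - s |x| * w) (b x * w + s |x| * w) (ρ * y) v - Psi (-(t * w)) (t * w) (ρ * y) v

lemma abs_excess_le_one (t ρ : ℝ) {v : ℝ} (hv : 0 < v) (b s : ℝ → ℝ) (w x y : ℝ) :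
    |excess t v ρ b s w x y| ≤ 1 := by
  obtain ⟨h₁, h₂⟩ := Psi_mem_Icc (b x * w - s |x| * w) (b x * w + s |x| * w) (ρ * y) hv
  obtain ⟨h₃, h₄⟩ := Psi_mem_Icc (-(t * w)) (t * w) (ρ * y) hv
  rw [excess, abs_le]
  constructor <;> linarith

lemma measurable_excess (t v ρ : ℝ) {b s : ℝ → ℝ} (hb : Measurable b)
    (hs : Measurable fun x => s |x|) :
    Measurable fun p : (ℝ × ℝ) × ℝ => excess t v ρ b s p.1.1 p.1.2 p.2 := by
  have hw : Measurable fun p : (ℝ × ℝ) × ℝ => p.1.1 := by fun_prop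
  have hb' : Measurable fun p : (ℝ × ℝ) × ℝ => b p.1.2 * p.1.1 :=
    (hb.comp (by fun_prop)).mul hw
  have hs' : Measurable fun p : (ℝ × ℝ) × ℝ => s |p.1.2| * p.1.1 :=
    (hs.comp (g := fun x => s |x|) (f := fun p : (ℝ × ℝ) × ℝ => p.1.2) (by fun_prop)).mul hw
  exact (Measurable.Psi v (hb'.sub hs') (hb'.add hs') (by fun_prop)).sub
    (Measurable.Psi v (by fun_prop) (by fun_prop) (by fun_prop))

lemma excess_neg {b : ℝ → ℝ} (hb : ∀ x, b (-x) = -b x) (t v ρ : ℝ) (s : ℝ → ℝ) (w x y : ℝ) :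
    excess t v ρ b s w (-x) (-y) =
      Psi (-(b x * w) - s |x| * w) (-(b x * w) + s |x| * w) (-(ρ * y)) v -
        Psi (-(t * w)) (t * w) (-(ρ * y)) v := by
  simp only [excess, hb, abs_neg, neg_mul, mul_neg]

lemma kfun_sub_kdag_eq_excess (t ρ : ℝ) (b s : ℝ → ℝ) {w : ℝ} (hw : 0 < w) (x γ : ℝ) :
    kfun b s ρ (w * x) w γ - kdag t ρ (w * x) w γ =
      excess t (1 - ρ ^ 2) ρ b s w x (w * x - γ) := by
  have h : |w * x| / w = |x| := by
    rw [abs_mul, abs_of_pos hw, mul_div_cancel_left₀ _ hw.ne']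
  rw [kfun, kdag, excess, h, mul_div_cancel_left₀ _ hw.ne']

/-- The integral of `R2` over `γ ∈ ℝ`, expressed as an explicit triple integral. -/
theorem integral_R2_eq
    (m : ℕ) (hm : 0 < m) (t d ρ : ℝ) (ht : 0 < t) (hd : 0 < d)
    (hρ₁ : -1 < ρ) (hρ₂ : ρ < 1)
    (b s : ℝ → ℝ) (hbs : MemF d t b s) :
    (∫ γ : ℝ, R2 m t d ρ b s γ) =
      -∫ x in (0 : ℝ)..d,
          ∫ w in Set.Ioi (0 : ℝ),
            (∫ y : ℝ,
                (Psi (b x * w - s x * w) (b x * w + s x * w) (ρ * y) (1 - ρ ^ 2) -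
                    Psi (-(t * w)) (t * w) (ρ * y) (1 - ρ ^ 2) +
                  Psi (-(b x * w) - s x * w) (-(b x * w) + s x * w) (-(ρ * y)) (1 - ρ ^ 2) -
                    Psi (-(t * w)) (t * w) (-(ρ * y)) (1 - ρ ^ 2)) * phi y) *
              (w * fW m w) := by
  have hv : 0 < 1 - ρ ^ 2 := by nlinarith
  set g := excess t (1 - ρ ^ 2) ρ b s with hg
  have hgm := measurable_excess t (1 - ρ ^ 2) ρ hbs.measurable_b hbs.measurable_s_abs
  rw [← hg] at hgm
  have hg1 : ∀ w x y, |g w x y| ≤ 1 := abs_excess_le_one t ρ hv b s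
  set μ : Measure ℝ := volume.restrict (Set.Ioi (0 : ℝ))
  set ν : Measure ℝ := volume.restrict (Set.Ioc (-d) d)
  have hInt : Integrable (fun p : (ℝ × ℝ) × ℝ =>
      g p.1.1 p.1.2 p.2 * phi p.2 * (p.1.1 * fW m p.1.1)) ((μ.prod ν).prod volume) := by
    have hdom := (((integrable_mul_fW hm).mul_prod
      (integrable_const (1 : ℝ) : Integrable _ ν)).mul_prod integrable_phi).bdd_mul
        hgm.aestronglyMeasurable (ae_of_all _ fun p => hg1 p.1.1 p.1.2 p.2)
    refine hdom.congr (ae_of_all _ fun p => ?_)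
    simp only [mul_one]
    ring
  have hIntx : ∀ x, Integrable (fun w => ∫ y, g w x y * phi y * (w * fW m w)) μ := by
    intro x
    have hmeas : Measurable fun p : ℝ × ℝ => g p.1 x p.2 :=
      hgm.comp (g := fun p : (ℝ × ℝ) × ℝ => g p.1.1 p.1.2 p.2)
        (f := fun p : ℝ × ℝ => ((p.1, x), p.2)) (by fun_prop)
    have hdom := ((integrable_mul_fW hm).mul_prod integrable_phi).bdd_mul
      hmeas.aestronglyMeasurable (ae_of_all _ fun p => hg1 p.1 x p.2)
    refine Integrable.integral_prod_left
      (f := fun p : ℝ × ℝ => g p.1 x p.2 * phi p.2 * (p.1 * fW m p.1))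
      (hdom.congr (ae_of_all _ fun p => ?_))
    ring
  have hInty : ∀ w x, Integrable fun y => g w x y * phi y := by
    intro w x
    have hmeas : Measurable fun y => g w x y :=
      hgm.comp (g := fun p : (ℝ × ℝ) × ℝ => g p.1.1 p.1.2 p.2)
        (f := fun y : ℝ => ((w, x), y)) (by fun_prop)
    exact integrable_phi.bdd_mul hmeas.aestronglyMeasurable
      (ae_of_all _ fun y => hg1 w x y)
  have hR2 : ∀ γ, R2 m t d ρ b s γ =
      -∫ w, ∫ x, g w x (w * x - γ) * phi (w * x - γ) * (w * fW m w) ∂ν ∂μ := by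
    intro γ
    rw [R2]
    congr 1
    refine setIntegral_congr_fun measurableSet_Ioi fun w hw => ?_
    have hw : 0 < w := hw
    simp only [kfun_sub_kdag_eq_excess t ρ b s hw]
    rw [intervalIntegral.integral_of_le (by linarith), ← integral_mul_const]
  simp_rw [hR2]
  rw [integral_neg, integral_integral_integral_sub_left
    (G := fun w x y => g w x y * phi y * (w * fW m w)) (τ := fun w x => w * x)
    (by fun_prop) hInt]
  congr 1
  have hJ : IntervalIntegrable (fun x => ∫ w, (∫ y, g w x y * phi y * (w * fW m w)) ∂μ)
      volume (-d) d := by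
    rw [intervalIntegrable_iff_integrableOn_Ioc_of_le (by linarith)]
    exact hInt.integral_prod_left.integral_prod_right
  rw [← intervalIntegral.integral_of_le (by linarith),
    integral_neg_to_self_eq_integral_add_neg hd.le hJ]
  refine intervalIntegral.integral_congr fun x hx => ?_
  rw [Set.uIcc_of_le hd.le] at hx
  have hsx : s |x| = s x := by rw [abs_of_nonneg hx.1]
  rw [← integral_add (hIntx x) (hIntx (-x))]
  refine integral_congr_ae (ae_of_all _ fun w => ?_)
  have hflip : ∫ y, g w (-x) y * phi y = ∫ y, g w (-x) (-y) * phi y := by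
    rw [← integral_neg_eq_self (fun y => g w (-x) y * phi y)]
    simp only [phi_neg]
  have hflipInt : Integrable fun y => g w (-x) (-y) * phi y := by
    simpa only [phi_neg] using (hInty w (-x)).comp_neg
  simp only [integral_mul_const]
  rw [hflip, ← add_mul, ← integral_add (hInty w x) hflipInt]
  congr 2 with y
  rw [hg, excess_neg hbs.b_odd, excess, hsx]
  ring
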